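/- Let M = M(S; F(I), G(Lambda); P) be a Rees matrix semigroup without zero over a semigroupoid S (so the sandwich matrix P has no zero entries). If M is a prefix-automatic semigroup then S is a prefix-automatic semigroupoid. -/

import Mathlib

/- Common framework: graphs, path languages, synchronous regularity,
   semigroupoids, automatic structures, and Rees matrix constructions. -/

namespace AutoRees

/-- Raw data of a semigroupoid: source and target maps on arrows together with a
totalised multiplication (whose values are only meaningful on composable pairs). -/
structure PreSgpd (O A : Type) where
  src : A → O
  tgt : A → O
  mul : A → A → A

/-- A semigroupoid: the multiplication respects sources and targets and is
associative, on composable pairs. -/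
structure Sgpd (O A : Type) extends PreSgpd O A where
  src_mul : ∀ e f, tgt e = src f → src (mul e f) = src e
  tgt_mul : ∀ e f, tgt e = src f → tgt (mul e f) = tgt f
  mul_assoc' : ∀ e f g, tgt e = src f → tgt f = src g →
    mul (mul e f) g = mul e (mul f g)

/-- Evaluate a nonempty word of edge labels as a product in the semigroupoid
(`none` on the empty word). -/
def evalPath? {O A E : Type} (S : PreSgpd O A) (lab : E → A) : List E → Option A
  | [] => none
  | e :: l => some ((l.map lab).foldl S.mul (lab e))

/-- The consecutive-compatibility condition making a list of edges a path. -/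
def IsPathChain {V E : Type} (esrc etgt : E → V) (l : List E) : Prop :=
  List.Chain' (fun e f => etgt e = esrc f) l

/-- The target of a non-empty path. -/
def pathTgt? {V E : Type} (etgt : E → V) (l : List E) : Option V :=
  l.getLast?.map etgt

/-- The source of a non-empty path. -/
def pathSrc? {V E : Type} (esrc : E → V) (l : List E) : Option V :=
  l.head?.map esrc

/-- A set of words is regular if it is a regular language in the usual sense. -/
def IsRegularSet {α : Type} (L : Set (List α)) : Prop :=
  Language.IsRegular (show Language α from L)

/-- The padding symbol used to pad a pair of paths, at the target of `l`
(the letters of the padded alphabet `X^$` are `Sum.inl` (a genuine edge) or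
`Sum.inr (some v)` (the padding edge at vertex `v`)). -/
def padSym {V E : Type} (etgt : E → V) (l : List E) : E ⊕ Option V :=
  Sum.inr (l.getLast?.map etgt)

/-- The padded convolution `(a, b) δ_X` of a pair of paths. -/
def deltaPair {V E : Type} (etgt : E → V) (a b : List E) :
    List ((E ⊕ Option V) × (E ⊕ Option V)) :=
  (a.map Sum.inl).zip (b.map Sum.inl) ++
    (if a.length ≤ b.length
      then (b.drop a.length).map (fun e => (padSym etgt a, Sum.inl e))
      else (a.drop b.length).map (fun e => (Sum.inl e, padSym etgt b)))

/-- A binary relation on paths is synchronously regular if its image under the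
padding map is a regular language over the padded product alphabet. -/
def SyncRegular {V E : Type} (etgt : E → V) (R : Set (List E × List E)) : Prop :=
  IsRegularSet { w | ∃ p ∈ R, w = deltaPair etgt p.1 p.2 }

/-- A choice of representatives `(X, K, ρ)` for a semigroupoid `S`: a graph `X`
with vertex set `S^0` (edge set `E`, source `esrc`, target `etgt`), a semigroupoid
morphism `ρ : X^+ → S` (induced by the edge-labelling `lab`), and a language `K`
of non-empty paths with `K ρ = S^1`. -/
structure ChoiceOfReps {O A : Type} (S : PreSgpd O A) (E : Type) where
  esrc : E → O
  etgt : E → O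
  lab : E → A
  lab_src : ∀ e, S.src (lab e) = esrc e
  lab_tgt : ∀ e, S.tgt (lab e) = etgt e
  K : Set (List E)
  K_path : ∀ l ∈ K, l ≠ [] ∧ IsPathChain esrc etgt l
  K_onto : ∀ a : A, ∃ l ∈ K, evalPath? S lab l = some a

variable {O A E : Type} {S : PreSgpd O A}

/-- The relation `K_=` = {(u,v) ∈ K × K : u ρ = v ρ}. -/
def relEq (C : ChoiceOfReps S E) : Set (List E × List E) :=
  { p | p.1 ∈ C.K ∧ p.2 ∈ C.K ∧ evalPath? S C.lab p.1 = evalPath? S C.lab p.2 }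

/-- The relation `K_a` for an edge `a` of `X`. -/
def relEdge (C : ChoiceOfReps S E) (a : E) : Set (List E × List E) :=
  { p | p.1 ∈ C.K ∧ p.2 ∈ C.K ∧ pathTgt? C.etgt p.1 = some (C.esrc a) ∧
        evalPath? S C.lab (p.1 ++ [a]) = evalPath? S C.lab p.2 }

/-- The relation `K_a` for a vertex `a` of `X` (regarded as the empty path at `a`). -/
def relVertex (C : ChoiceOfReps S E) (v : O) : Set (List E × List E) :=
  { p | p.1 ∈ C.K ∧ p.2 ∈ C.K ∧ pathTgt? C.etgt p.1 = some v ∧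
        evalPath? S C.lab p.1 = evalPath? S C.lab p.2 }

/-- An automatic structure: a finitely generated choice of representatives with
`K` regular such that `K_a` is synchronously regular for every edge and vertex. -/
def IsAutomaticStructure (C : ChoiceOfReps S E) : Prop :=
  Finite E ∧ IsRegularSet C.K ∧
    (∀ a : E, SyncRegular C.etgt (relEdge C a)) ∧
    (∀ v : O, SyncRegular C.etgt (relVertex C v))

/-- The set of non-empty prefixes of words in `K`. -/
def prefs {E : Type} (K : Set (List E)) : Set (List E) :=
  { p | p ≠ [] ∧ ∃ l ∈ K, p <+: l }

/-- The relation `K'_=` = {(u,v) ∈ K × Pref(K) : u ρ = v ρ}. -/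
def relPrefEq (C : ChoiceOfReps S E) : Set (List E × List E) :=
  { p | p.1 ∈ C.K ∧ p.2 ∈ prefs C.K ∧ evalPath? S C.lab p.1 = evalPath? S C.lab p.2 }

/-- A prefix-automatic structure. -/
def IsPrefixAutomaticStructure (C : ChoiceOfReps S E) : Prop :=
  IsAutomaticStructure C ∧ SyncRegular C.etgt (relPrefEq C)

/-- A cross-section: `ρ` restricted to `K` is injective. -/
def IsCrossSection (C : ChoiceOfReps S E) : Prop :=
  ∀ u ∈ C.K, ∀ v ∈ C.K, evalPath? S C.lab u = evalPath? S C.lab v → u = v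

/-- `K` is closed under taking non-empty prefixes. -/
def IsPrefixClosed (C : ChoiceOfReps S E) : Prop :=
  ∀ l ∈ C.K, ∀ p : List E, p ≠ [] → p <+: l → p ∈ C.K

/-- A semigroupoid (or semigroup, in the one-object case) is automatic if it
admits an automatic structure. -/
def IsAutomatic (S : PreSgpd O A) : Prop :=
  ∃ (E : Type) (C : ChoiceOfReps S E), IsAutomaticStructure C

/-- Prefix-automaticity. -/
def IsPrefixAutomatic (S : PreSgpd O A) : Prop :=
  ∃ (E : Type) (C : ChoiceOfReps S E), IsPrefixAutomaticStructure C

/-- Finite generation: every arrow is a (composable) product of arrows from some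
fixed finite set. -/
def IsFG (S : PreSgpd O A) : Prop :=
  ∃ T : Set A, T.Finite ∧ ∀ a : A, ∃ l : List A, l ≠ [] ∧ (∀ x ∈ l, x ∈ T) ∧
    IsPathChain S.src S.tgt l ∧ evalPath? S id l = some a

/-- An arrow is an identity if it acts as an identity on all composable products. -/
def IsIdentity (S : PreSgpd O A) (e : A) : Prop :=
  (∀ x, S.tgt e = S.src x → S.mul e x = x) ∧ (∀ y, S.tgt y = S.src e → S.mul y e = y)

/-- A small category is a semigroupoid with an identity arrow at every object. -/
def IsSmallCategory (S : PreSgpd O A) : Prop :=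
  ∀ v : O, ∃ e : A, S.src e = v ∧ S.tgt e = v ∧ IsIdentity S e

/-- No object is isolated. -/
def IsolationFree (S : PreSgpd O A) : Prop :=
  ∀ v : O, ∃ a : A, S.src a = v ∨ S.tgt a = v

namespace Rees

variable {O A I Λ : Type}

/-- A triple `(i, x, λ)` is valid if `i F = x α` and `x ω = λ G`. -/
def Valid (S : Sgpd O A) (F : I → O) (G : Λ → O) (t : I × A × Λ) : Prop :=
  F t.1 = S.src t.2.1 ∧ S.tgt t.2.1 = G t.2.2

/-- The set of valid Rees triples. -/
def Triples (S : Sgpd O A) (F : I → O) (G : Λ → O) : Type :=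
  { t : I × A × Λ // Valid S F G t }

theorem prod_valid (S : Sgpd O A) {F : I → O} {G : Λ → O}
    {i : I} {x : A} {lam : Λ} {j : I} {y : A} {mu : Λ} {p : A}
    (hx : Valid S F G (i, x, lam)) (hy : Valid S F G (j, y, mu))
    (hps : S.src p = G lam) (hpt : S.tgt p = F j) :
    Valid S F G (i, S.mul (S.mul x p) y, mu) := by
  obtain ⟨hx1, hx2⟩ := hx
  obtain ⟨hy1, hy2⟩ := hy
  have h1 : S.tgt x = S.src p := by rw [hps]; exact hx2
  have h2 : S.tgt p = S.src y := by rw [hpt]; exact hy1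
  have h3 : S.tgt (S.mul x p) = S.src y := by rw [S.tgt_mul x p h1]; exact h2
  constructor
  · show F i = S.src (S.mul (S.mul x p) y)
    rw [S.src_mul _ y h3, S.src_mul x p h1]; exact hx1
  · show S.tgt (S.mul (S.mul x p) y) = G mu
    rw [S.tgt_mul _ y h3]; exact hy2

/-- Data for a Rees matrix construction with zero over a semigroupoid `S`:
indexing functions `F`, `G` surjective onto the sets of sources and of targets
respectively, and a sandwich matrix `P` with entries in `S^1 ∪ {0}`
(`none` representing `0`) compatible with `F` and `G`. -/
structure Data0 (S : Sgpd O A) (I Λ : Type) where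
  F : I → O
  G : Λ → O
  P : Λ → I → Option A
  F_into : ∀ i, ∃ a : A, S.src a = F i
  F_onto : ∀ a : A, ∃ i, F i = S.src a
  G_into : ∀ lam, ∃ a : A, S.tgt a = G lam
  G_onto : ∀ a : A, ∃ lam, G lam = S.tgt a
  P_src : ∀ lam i p, P lam i = some p → S.src p = G lam
  P_tgt : ∀ lam i p, P lam i = some p → S.tgt p = F i

/-- Underlying set of the Rees matrix semigroup with zero (`none` is the zero). -/
def Carrier0 (S : Sgpd O A) (R : Data0 S I Λ) : Type :=
  Option (Triples S R.F R.G)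

/-- Multiplication of the Rees matrix semigroup with zero. -/
def mul0 (S : Sgpd O A) (R : Data0 S I Λ) :
    Carrier0 S R → Carrier0 S R → Carrier0 S R
  | some ⟨(i, x, lam), hx⟩, some ⟨(j, y, mu), hy⟩ =>
    match hp : R.P lam j with
    | some p => some ⟨(i, S.mul (S.mul x p) y, mu),
        prod_valid S hx hy (R.P_src lam j p hp) (R.P_tgt lam j p hp)⟩
    | none => none
  | none, _ => none
  | _, none => none

/-- The Rees matrix semigroup with zero `M^0(S; F(I), G(Λ); P)`, as a
one-object semigroupoid (i.e. a semigroup). -/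
def pre0 (S : Sgpd O A) (R : Data0 S I Λ) : PreSgpd Unit (Carrier0 S R) where
  src _ := ()
  tgt _ := ()
  mul := mul0 S R

/-- Data for a Rees matrix construction without zero (no zero entries in `P`). -/
structure Data (S : Sgpd O A) (I Λ : Type) where
  F : I → O
  G : Λ → O
  P : Λ → I → A
  F_into : ∀ i, ∃ a : A, S.src a = F i
  F_onto : ∀ a : A, ∃ i, F i = S.src a
  G_into : ∀ lam, ∃ a : A, S.tgt a = G lam
  G_onto : ∀ a : A, ∃ lam, G lam = S.tgt a
  P_src : ∀ lam i, S.src (P lam i) = G lam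
  P_tgt : ∀ lam i, S.tgt (P lam i) = F i

/-- Underlying set of the Rees matrix semigroup without zero. -/
def Carrier (S : Sgpd O A) (R : Data S I Λ) : Type :=
  Triples S R.F R.G

/-- Multiplication of the Rees matrix semigroup without zero. -/
def mul (S : Sgpd O A) (R : Data S I Λ) :
    Carrier S R → Carrier S R → Carrier S R
  | ⟨(i, x, lam), hx⟩, ⟨(j, y, mu), hy⟩ =>
    ⟨(i, S.mul (S.mul x (R.P lam j)) y, mu),
      prod_valid S hx hy (R.P_src lam j) (R.P_tgt lam j)⟩

/-- The Rees matrix semigroup without zero `M(S; F(I), G(Λ); P)`, as a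
one-object semigroupoid (i.e. a semigroup). -/
def pre (S : Sgpd O A) (R : Data S I Λ) : PreSgpd Unit (Carrier S R) where
  src _ := ()
  tgt _ := ()
  mul := mul S R

/-- The set `S P' S` of arrows of the form `s p t` with `p` a non-zero entry of `P`. -/
def SPS0 (S : Sgpd O A) (R : Data0 S I Λ) : Set A :=
  { a | ∃ s p t lam i, R.P lam i = some p ∧ S.tgt s = S.src p ∧ S.tgt p = S.src t ∧
        a = S.mul (S.mul s p) t }

/-- The set `S P S` for a matrix without zero entries. -/
def SPS (S : Sgpd O A) (R : Data S I Λ) : Set A :=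
  { a | ∃ s t lam i, S.tgt s = S.src (R.P lam i) ∧ S.tgt (R.P lam i) = S.src t ∧
        a = S.mul (S.mul s (R.P lam i)) t }

/-- The set of targets of arrows of `S` (the codomain of `G`). -/
def tgtSet (S : Sgpd O A) : Set O := { v | ∃ a : A, S.tgt a = v }

/-- `T` is strongly right-ideal-generated by a row cross-section of `P`. -/
def StronglyRIG0 (S : Sgpd O A) (R : Data0 S I Λ) (T : Set A) : Prop :=
  ∃ Λ' : Set Λ, Set.BijOn R.G Λ' (tgtSet S) ∧
    ∀ t ∈ T, ∃ lam ∈ Λ', ∃ i p s, R.P lam i = some p ∧ S.tgt p = S.src s ∧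
      t = S.mul p s

/-- `T` is weakly right-ideal-generated by a row cross-section of `P`. -/
def WeaklyRIG0 (S : Sgpd O A) (R : Data0 S I Λ) (T : Set A) : Prop :=
  ∃ Λ' : Set Λ, Set.BijOn R.G Λ' (tgtSet S) ∧
    ∀ t ∈ T, ∃ lam ∈ Λ', ∃ i p, R.P lam i = some p ∧
      (t = p ∨ ∃ s, S.tgt p = S.src s ∧ t = S.mul p s)

/-- Weak right-ideal generation, for a matrix without zero entries. -/
def WeaklyRIG (S : Sgpd O A) (R : Data S I Λ) (T : Set A) : Prop :=
  ∃ Λ' : Set Λ, Set.BijOn R.G Λ' (tgtSet S) ∧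
    ∀ t ∈ T, ∃ lam ∈ Λ', ∃ i,
      (t = R.P lam i ∨ ∃ s, S.tgt (R.P lam i) = S.src s ∧ t = S.mul (R.P lam i) s)

end Rees


end AutoRees

namespace AutoRees

section Reg
variable {α β : Type}

theorem reg_of_dfa {σ : Type} [Finite σ] (M : DFA α σ) (L : Set (List α))
    (h : ∀ w, w ∈ L ↔ M.eval w ∈ M.accept) : IsRegularSet L := by
  have := Fintype.ofFinite σ
  refine ⟨σ, this, M, ?_⟩
  ext w
  exact (h w).symm

theorem reg_exists {L : Set (List α)} (h : IsRegularSet L) :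
    ∃ (σ : Type) (_ : Finite σ) (M : DFA α σ), ∀ w, w ∈ L ↔ M.eval w ∈ M.accept := by
  obtain ⟨σ, hf, M, hM⟩ := h
  refine ⟨σ, Finite.of_fintype σ, M, fun w => ?_⟩
  have : w ∈ M.accepts ↔ w ∈ L := by rw [hM]; rfl
  exact this.symm

theorem reg_inter {L L' : Set (List α)} (h : IsRegularSet L) (h' : IsRegularSet L') :
    IsRegularSet (L ∩ L') := Language.IsRegular.inf h h'

theorem reg_union {L L' : Set (List α)} (h : IsRegularSet L) (h' : IsRegularSet L') :
    IsRegularSet (L ∪ L') := Language.IsRegular.add h h'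

theorem reg_and {p q : List α → Prop} (h : IsRegularSet {w | p w}) (h' : IsRegularSet {w | q w}) :
    IsRegularSet {w | p w ∧ q w} := reg_inter h h'

theorem reg_empty : IsRegularSet (∅ : Set (List α)) := by
  refine reg_of_dfa (σ := Unit) ⟨fun _ _ => (), (), ∅⟩ _ ?_
  intro w; simp

theorem reg_iUnion {ι : Type} [Finite ι] (L : ι → Set (List α)) (h : ∀ i, IsRegularSet (L i)) :
    IsRegularSet (⋃ i, L i) := by
  have key : ∀ s : Set ι, s.Finite → IsRegularSet (⋃ i ∈ s, L i) := by
    intro s hs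
    induction s, hs using Set.Finite.induction_on with
    | empty => simpa using reg_empty
    | insert _ _ ih => rw [Set.biUnion_insert]; exact reg_union (h _) ih
  simpa using key Set.univ Set.finite_univ

theorem reg_filterMap (f : α → Option β) {L : Set (List β)} (h : IsRegularSet L) :
    IsRegularSet {w | w.filterMap f ∈ L} := by
  obtain ⟨σ, hσ, M, hM⟩ := reg_exists h
  let M' : DFA α σ := ⟨fun s a => (f a).elim s (M.step s), M.start, M.accept⟩
  refine reg_of_dfa M' _ ?_
  have : ∀ w s, M'.evalFrom s w = M.evalFrom s (w.filterMap f) := by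
    intro w
    induction w with
    | nil => intro s; rfl
    | cons a w ih =>
      intro s
      rw [DFA.evalFrom_cons, ih, List.filterMap_cons]
      cases hf : f a <;> simp [M', hf]
  intro w
  show _ ↔ M'.evalFrom M.start w ∈ M.accept
  rw [this]
  exact hM _

theorem reg_comap (f : α → β) {L : Set (List β)} (h : IsRegularSet L) :
    IsRegularSet {w | w.map f ∈ L} := by
  simpa [List.filterMap_eq_map'] using reg_filterMap (fun a => some (f a)) h

theorem reg_image (f : α → β) {L : Set (List α)} (h : IsRegularSet L) :
    IsRegularSet (List.map f '' L) := by
  obtain ⟨σ, hσ, M, hM⟩ := reg_exists h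
  let M' : DFA β (Set σ) :=
    ⟨fun S b => {s' | ∃ s ∈ S, ∃ a, f a = b ∧ M.step s a = s'}, {M.start},
      {S | ∃ s ∈ S, s ∈ M.accept}⟩
  refine reg_of_dfa M' _ ?_
  have : ∀ (w : List β) S, M'.evalFrom S w =
      {s' | ∃ s ∈ S, ∃ z, z.map f = w ∧ M.evalFrom s z = s'} := by
    intro w
    induction w with
    | nil => intro S; ext; simp
    | cons b w ih =>
      intro S
      rw [DFA.evalFrom_cons, ih]
      ext s'
      constructor
      · rintro ⟨s, ⟨t, ht, a, rfl, rfl⟩, z, rfl, rfl⟩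
        exact ⟨t, ht, a :: z, rfl, rfl⟩
      · rintro ⟨s, hs, z, hz, rfl⟩
        rcases z with _ | ⟨a, z⟩
        · simp at hz
        · simp only [List.map_cons, List.cons.injEq] at hz
          obtain ⟨rfl, rfl⟩ := hz
          exact ⟨_, ⟨s, hs, a, rfl, rfl⟩, z, rfl, rfl⟩
  intro w
  show _ ↔ M'.evalFrom {M.start} w ∈ {S : Set σ | ∃ s ∈ S, s ∈ M.accept}
  rw [this]
  constructor
  · rintro ⟨z, hz, rfl⟩
    exact ⟨_, ⟨_, rfl, z, rfl, rfl⟩, (hM z).1 hz⟩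
  · rintro ⟨_, ⟨_, rfl, z, rfl, rfl⟩, h⟩
    exact ⟨z, (hM z).2 h, rfl⟩

theorem reg_quot (Z : Set (List α)) {L : Set (List α)} (h : IsRegularSet L) :
    IsRegularSet {w | ∃ z ∈ Z, w ++ z ∈ L} := by
  obtain ⟨σ, hσ, M, hM⟩ := reg_exists h
  let M' : DFA α σ := ⟨M.step, M.start, {s | ∃ z ∈ Z, M.evalFrom s z ∈ M.accept}⟩
  refine reg_of_dfa M' _ ?_
  intro w
  show (∃ z ∈ Z, w ++ z ∈ L) ↔ ∃ z ∈ Z, M.evalFrom (M.evalFrom M.start w) z ∈ M.accept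
  simp only [hM, DFA.eval, DFA.evalFrom_of_append]

theorem reg_getLast [Finite α] (q : Option α → Prop) : IsRegularSet {w : List α | q w.getLast?} := by
  let M : DFA α (Option α) := ⟨fun _ a => some a, none, {o | q o}⟩
  refine reg_of_dfa M _ ?_
  have : ∀ w, M.eval w = w.getLast? := by
    intro w
    induction w using List.reverseRecOn with
    | nil => rfl
    | append_singleton w a _ => simp [M]
  intro w
  rw [this]; rfl

open Classical in
theorem reg_chain [Finite α] (p : α → Prop) (r : α → α → Prop) :
    IsRegularSet {w : List α | (∀ a ∈ w.head?, p a) ∧ w.IsChain r} := by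
  let M : DFA α (Option (Option α)) :=
    ⟨fun s a => match s with
      | none => none
      | some none => if p a then some (some a) else none
      | some (some b) => if r b a then some (some a) else none, some none, {s | s ≠ none}⟩
  have h0 : ∀ w, M.evalFrom none w = none := by
    intro w
    induction w with
    | nil => rfl
    | cons a w ih => exact ih
  have h1 : ∀ w b, M.evalFrom (some (some b)) w ≠ none ↔ (b :: w).IsChain r := by
    intro w
    induction w with
    | nil => intro b; simp
    | cons a w ih =>
      intro b
      rw [DFA.evalFrom_cons, List.isChain_cons_cons]
      by_cases hr : r b a
      · have : M.step (some (some b)) a = some (some a) := by simp [M, hr]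
        rw [this, ih]; simp [hr]
      · have : M.step (some (some b)) a = none := by simp [M, hr]
        rw [this, h0]; simp [hr]
  refine reg_of_dfa M _ ?_
  intro w
  show _ ↔ M.evalFrom (some none) w ≠ none
  cases w with
  | nil => simp
  | cons a w =>
    rw [DFA.evalFrom_cons]
    by_cases hr : p a
    · have : M.step (some none) a = some (some a) := by simp [M, hr]
      rw [this, h1]; simp [hr]
    · have : M.step (some none) a = none := by simp [M, hr]
      rw [this, h0]; simp [hr]

theorem reg_chain' [Finite α] (r : α → α → Prop) :
    IsRegularSet {w : List α | w.IsChain r} := by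
  simpa using reg_chain (fun _ => True) r

theorem reg_head [Finite α] (p : α → Prop) :
    IsRegularSet {w : List α | ∀ a ∈ w.head?, p a} := by
  have h := reg_chain p (fun _ _ => True)
  have : ∀ w : List α, w.IsChain (fun _ _ => True) := by
    intro w
    induction w with
    | nil => simp
    | cons a w ih => rw [List.isChain_cons]; exact ⟨by simp, ih⟩
  simpa [this] using h

theorem reg_all [Finite α] (p : α → Prop) : IsRegularSet {w : List α | ∀ a ∈ w, p a} := by
  have h := reg_chain p (fun _ a => p a)
  convert h using 3 with w
  induction w with
  | nil => simp
  | cons a w ih =>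
    rw [List.isChain_cons]
    simp only [List.mem_cons, forall_eq_or_imp, ih]
    simp

theorem reg_singleton (k : List α) : IsRegularSet ({k} : Set (List α)) := by
  apply Language.IsRegular.of_finite_range_leftQuotient
  set L : Language α := (show Language α from {k})
  refine ((List.finite_toSet k.inits).image L.leftQuotient |>.insert (0 : Language α)).subset ?_
  rintro _ ⟨x, rfl⟩
  by_cases hx : x <+: k
  · right; exact ⟨x, by simpa using hx, rfl⟩
  · left
    ext y
    constructor
    · intro hy
      have : x ++ y = k := hy
      exact hx ⟨y, this⟩
    · intro h; exact h.elim

end Reg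

section Pad
variable {E : Type}

/-- `w` is the word `u` padded at the end. -/
def IsPad (w : List (Option E)) (u : List E) : Prop :=
  w.IsChain (fun a b => a = none → b = none) ∧ w.reduceOption = u

theorem chain_none (w : List (Option E)) :
    (none :: w).IsChain (fun a b => a = none → b = none) ↔ ∃ k, w = List.replicate k none := by
  induction w with
  | nil => exact ⟨fun _ => ⟨0, rfl⟩, fun _ => by simp⟩
  | cons a w ih =>
    rw [List.isChain_cons_cons]
    constructor
    · rintro ⟨h, h'⟩
      obtain rfl := h rfl
      obtain ⟨k, rfl⟩ := ih.1 h'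
      exact ⟨k+1, rfl⟩
    · rintro ⟨k, hk⟩
      cases k with
      | zero => simp at hk
      | succ k =>
        simp only [List.replicate_succ, List.cons.injEq] at hk
        obtain ⟨rfl, rfl⟩ := hk
        exact ⟨fun _ => rfl, ih.2 ⟨k, rfl⟩⟩

theorem isPad_nil (w : List (Option E)) : IsPad w [] ↔ ∃ k, w = List.replicate k none := by
  constructor
  · rintro ⟨h, h'⟩
    obtain ⟨n, hn⟩ := (List.reduceOption_eq_nil_iff w).1 h'
    exact ⟨n, hn⟩
  · rintro ⟨k, rfl⟩
    exact ⟨List.isChain_replicate_of_rel _ (by simp), by simp⟩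

theorem isPad_cons_some (x : E) (w : List (Option E)) (u : List E) :
    IsPad (some x :: w) u ↔ ∃ u', u = x :: u' ∧ IsPad w u' := by
  unfold IsPad
  rw [List.isChain_cons]
  simp only [List.reduceOption_cons_of_some]
  constructor
  · rintro ⟨⟨_, h⟩, rfl⟩; exact ⟨_, rfl, h, rfl⟩
  · rintro ⟨u', rfl, h, rfl⟩; simpa using h

theorem isPad_cons_none (w : List (Option E)) (u : List E) :
    IsPad (none :: w) u ↔ u = [] ∧ ∃ k, w = List.replicate k none := by
  unfold IsPad
  rw [chain_none]
  simp only [List.reduceOption_cons_of_none]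
  constructor
  · rintro ⟨⟨k, rfl⟩, rfl⟩; exact ⟨by simp, k, rfl⟩
  · rintro ⟨rfl, k, rfl⟩; exact ⟨⟨k, rfl⟩, by simp⟩

theorem isPad_mk (u : List E) (k : ℕ) : IsPad (u.map some ++ List.replicate k none) u := by
  induction u with
  | nil => exact (isPad_nil _).2 ⟨k, rfl⟩
  | cons x u ih => exact (isPad_cons_some _ _ _).2 ⟨u, rfl, ih⟩

theorem isPad_append_none (w : List (Option E)) (u : List E) (k : ℕ) :
    IsPad (w ++ List.replicate k none) u ↔ IsPad w u := by
  induction w generalizing u with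
  | nil =>
    constructor
    · rintro ⟨_, rfl⟩; simp [IsPad]
    · rintro ⟨_, rfl⟩; exact (isPad_nil _).2 ⟨k, rfl⟩
  | cons a w ih =>
    cases a with
    | some x => simp only [List.cons_append, isPad_cons_some, ih]
    | none =>
      simp only [List.cons_append, isPad_cons_none]
      refine and_congr_right fun _ => ?_
      constructor
      · rintro ⟨n, hn⟩
        have := List.eq_replicate_iff.1 hn
        exact ⟨w.length, List.eq_replicate_iff.2 ⟨rfl, fun b hb => this.2 b (by simp [hb])⟩⟩
      · rintro ⟨n, rfl⟩; exact ⟨n + k, by simp⟩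

/-- Padded version of a relation. -/
def Pd (R : Set (List E × List E)) : Set (List (Option E × Option E)) :=
  {w | ∃ p ∈ R, IsPad (w.map Prod.fst) p.1 ∧ IsPad (w.map Prod.snd) p.2}

/-- Regular relation. -/
def RR (R : Set (List E × List E)) : Prop := IsRegularSet (Pd R)

theorem mem_Pd {R : Set (List E × List E)} {w} {u v : List E} (h1 : IsPad (w.map Prod.fst) u)
    (h2 : IsPad (w.map Prod.snd) v) : w ∈ Pd R ↔ (u, v) ∈ R := by
  constructor
  · rintro ⟨⟨a, b⟩, h, h3, h4⟩
    obtain rfl : a = u := h3.2.symm.trans h1.2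
    obtain rfl : b = v := h4.2.symm.trans h2.2
    exact h
  · intro h; exact ⟨_, h, h1, h2⟩

theorem RR.inter {R T : Set (List E × List E)} (h : RR R) (h' : RR T) : RR (R ∩ T) := by
  have := reg_inter h h'
  unfold RR
  convert this using 1
  ext w
  constructor
  · rintro ⟨p, hp, h1, h2⟩; exact ⟨⟨p, hp.1, h1, h2⟩, ⟨p, hp.2, h1, h2⟩⟩
  · rintro ⟨⟨⟨u, v⟩, hp, h1, h2⟩, h3⟩
    exact ⟨_, ⟨hp, (mem_Pd h1 h2).1 h3⟩, h1, h2⟩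

theorem RR.union {R T : Set (List E × List E)} (h : RR R) (h' : RR T) : RR (R ∪ T) := by
  have := reg_union h h'
  unfold RR
  convert this using 1
  ext w
  constructor
  · rintro ⟨p, hp | hp, h1, h2⟩
    · exact Or.inl ⟨p, hp, h1, h2⟩
    · exact Or.inr ⟨p, hp, h1, h2⟩
  · rintro (⟨p, hp, h1, h2⟩ | ⟨p, hp, h1, h2⟩)
    · exact ⟨p, Or.inl hp, h1, h2⟩
    · exact ⟨p, Or.inr hp, h1, h2⟩

theorem RR.iUnion {ι : Type} [Finite ι] {R : ι → Set (List E × List E)} (h : ∀ i, RR (R i)) :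
    RR (⋃ i, R i) := by
  have := reg_iUnion _ h
  unfold RR
  convert this using 1
  ext w
  simp only [Pd, Set.mem_iUnion, Set.mem_ofPred_eq]
  grind

theorem RR.swap {R : Set (List E × List E)} (h : RR R) : RR {p | (p.2, p.1) ∈ R} := by
  have := reg_comap (Prod.swap (α := Option E) (β := Option E)) h
  unfold RR
  convert this using 1
  ext w
  simp only [Pd, Set.mem_ofPred_eq, List.map_map, Prod.exists]
  constructor
  · rintro ⟨a, b, h, h1, h2⟩; exact ⟨b, a, h, h2, h1⟩
  · rintro ⟨a, b, h, h1, h2⟩; exact ⟨b, a, h, h2, h1⟩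

theorem reg_isPad [Finite E] : IsRegularSet {w : List (Option E × Option E) |
    (∃ u, IsPad (w.map Prod.fst) u) ∧ ∃ u, IsPad (w.map Prod.snd) u} := by
  have h := reg_chain' (fun a b : Option E => a = none → b = none)
  have := reg_and (reg_comap (α := Option E × Option E) Prod.fst h) (reg_comap Prod.snd h)
  simpa [IsPad] using this

theorem RR.prod [Finite E] {L T : Set (List E)} (h : IsRegularSet L) (h' : IsRegularSet T) :
    RR {p | p.1 ∈ L ∧ p.2 ∈ T} := by
  have := reg_and reg_isPad (reg_and
    (reg_comap (α := Option E × Option E) Prod.fst (reg_filterMap id h))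
    (reg_comap (α := Option E × Option E) Prod.snd (reg_filterMap id h')))
  unfold RR
  convert this using 1
  ext w
  constructor
  · rintro ⟨p, hp, h1, h2⟩
    refine ⟨⟨⟨_, h1⟩, _, h2⟩, ?_, ?_⟩
    · have := h1.2; unfold List.reduceOption at this
      simpa only [Set.mem_ofPred_eq, this] using hp.1
    · have := h2.2; unfold List.reduceOption at this
      simpa only [Set.mem_ofPred_eq, this] using hp.2
  · rintro ⟨⟨⟨u, h1⟩, v, h2⟩, h3, h4⟩
    refine ⟨(u, v), ⟨?_, ?_⟩, h1, h2⟩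
    · rw [← h1.2]; exact h3
    · rw [← h2.2]; exact h4

theorem RR.comp {R T : Set (List E × List E)} (h : RR R) (h' : RR T) :
    RR {p | ∃ v, (p.1, v) ∈ R ∧ (v, p.2) ∈ T} := by
  have h3 := reg_quot {z | ∃ k, z = List.replicate k (none, none)}
    (reg_image (fun t : Option E × Option E × Option E => (t.1, t.2.2)) (reg_and
    (reg_comap (fun t : Option E × Option E × Option E => (t.1, t.2.1)) h)
    (reg_comap (fun t : Option E × Option E × Option E => (t.2.1, t.2.2)) h')))
  unfold RR
  convert h3 using 1
  ext w
  constructor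
  · rintro ⟨⟨u, y⟩, ⟨v, h1, h2⟩, hu, hy⟩
    refine ⟨_, ⟨v.length, rfl⟩, ?_⟩
    set W := w ++ List.replicate v.length ((none, none) : Option E × Option E) with hW
    set V := v.map some ++ List.replicate w.length (none : Option E) with hV
    have hlen : W.length = V.length := by simp [hW, hV, Nat.add_comm]
    refine ⟨List.zipWith (fun p m => (p.1, m, p.2)) W V, ?_, ?_⟩
    · have e1 : ∀ (W : List (Option E × Option E)) (V : List (Option E)), W.length = V.length →
          (List.zipWith (fun p m => (p.1, m, p.2)) W V).map (fun t => t.1) = W.map Prod.fst ∧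
          (List.zipWith (fun p m => (p.1, m, p.2)) W V).map (fun t => t.2.1) = V ∧
          (List.zipWith (fun p m => (p.1, m, p.2)) W V).map (fun t => t.2.2) = W.map Prod.snd := by
        intro W
        induction W with
        | nil => intro V hV; cases V <;> simp_all
        | cons a W ih =>
          intro V hV
          cases V with
          | nil => simp at hV
          | cons b V =>
            have := ih V (by simpa using hV)
            simp [this]
      obtain ⟨a1, a2, a3⟩ := e1 W V hlen
      have hu' : IsPad (W.map Prod.fst) u := by
        simp only [hW, List.map_append, List.map_replicate]
        exact (isPad_append_none _ _ _).2 hu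
      have hy' : IsPad (W.map Prod.snd) y := by
        simp only [hW, List.map_append, List.map_replicate]
        exact (isPad_append_none _ _ _).2 hy
      have hv' : IsPad V v := isPad_mk _ _
      constructor
      · refine ⟨(u, v), h1, ?_, ?_⟩
        · rw [List.map_map]; exact (a1 ▸ hu' :)
        · rw [List.map_map]; exact (a2.symm ▸ hv' :)
      · refine ⟨(v, y), h2, ?_, ?_⟩
        · rw [List.map_map]; exact (a2.symm ▸ hv' :)
        · rw [List.map_map]; exact (a3 ▸ hy' :)
    · have e1 : ∀ (W : List (Option E × Option E)) (V : List (Option E)), W.length = V.length →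
          (List.zipWith (fun p m => (p.1, m, p.2)) W V).map (fun t => (t.1, t.2.2)) = W := by
        intro W
        induction W with
        | nil => intro V hV; cases V <;> simp_all
        | cons a W ih =>
          intro V hV
          cases V with
          | nil => simp at hV
          | cons b V =>
            have := ih V (by simpa using hV)
            simp [this]
      exact e1 W V hlen
  · rintro ⟨_, ⟨k, rfl⟩, z, ⟨⟨⟨u, v⟩, h1, h2, h3⟩, ⟨⟨v', y⟩, h4, h5, h6⟩⟩, h7⟩
    rw [List.map_map] at h2 h3 h5 h6
    obtain rfl : v = v' := h3.2.symm.trans h5.2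
    refine ⟨(u, y), ⟨v, h1, h4⟩, ?_, ?_⟩
    · have := congrArg (List.map Prod.fst) h7
      rw [List.map_map, List.map_append, List.map_replicate] at this
      rw [← isPad_append_none _ _ k, ← this]
      exact h2
    · have := congrArg (List.map Prod.snd) h7
      rw [List.map_map, List.map_append, List.map_replicate] at this
      rw [← isPad_append_none _ _ k, ← this]
      exact h6

/-- Convolution of two words. -/
def conv : List E → List E → List (Option E × Option E)
  | [], [] => []
  | x :: u, [] => (some x, none) :: conv u []
  | [], y :: v => (none, some y) :: conv [] v
  | x :: u, y :: v => (some x, some y) :: conv u v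

/-- Erase the doubly padded letters. -/
def er : Option E × Option E → Option (Option E × Option E)
  | (none, none) => none
  | p => some p

theorem conv_fst : ∀ u v : List E, ((conv u v).map Prod.fst).reduceOption = u
  | [], [] => by simp [conv]
  | x :: u, [] => by simp [conv, conv_fst u []]
  | [], y :: v => by simp [conv, conv_fst [] v]
  | x :: u, y :: v => by simp [conv, conv_fst u v]

theorem conv_snd : ∀ u v : List E, ((conv u v).map Prod.snd).reduceOption = v
  | [], [] => by simp [conv]
  | x :: u, [] => by simp [conv, conv_snd u []]
  | [], y :: v => by simp [conv, conv_snd [] v]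
  | x :: u, y :: v => by simp [conv, conv_snd u v]

theorem er_fst (w : List (Option E × Option E)) :
    ((w.filterMap er).map Prod.fst).reduceOption = (w.map Prod.fst).reduceOption := by
  induction w with
  | nil => rfl
  | cons p w ih =>
    obtain ⟨_ | x, _ | y⟩ := p <;> simp [er, ih, List.filterMap_cons]

theorem er_snd (w : List (Option E × Option E)) :
    ((w.filterMap er).map Prod.snd).reduceOption = (w.map Prod.snd).reduceOption := by
  induction w with
  | nil => rfl
  | cons p w ih =>
    obtain ⟨_ | x, _ | y⟩ := p <;> simp [er, ih, List.filterMap_cons]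

theorem er_conv (w : List (Option E × Option E)) (u v : List E)
    (hu : IsPad (w.map Prod.fst) u) (hv : IsPad (w.map Prod.snd) v) :
    w.filterMap er = conv u v := by
  induction w generalizing u v with
  | nil =>
    obtain rfl : [] = u := hu.2
    obtain rfl : [] = v := hv.2
    simp [conv]
  | cons p w ih =>
    obtain ⟨_ | x, _ | y⟩ := p <;>
      simp only [List.map_cons, isPad_cons_none, isPad_cons_some] at hu hv
    · obtain ⟨rfl, hu⟩ := hu
      obtain ⟨rfl, hv⟩ := hv
      simp only [List.filterMap_cons, er]
      exact ih _ _ ((isPad_nil _).2 hu) ((isPad_nil _).2 hv)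
    · obtain ⟨rfl, hu⟩ := hu
      obtain ⟨v', rfl, hv⟩ := hv
      simp only [List.filterMap_cons, er, conv]
      rw [ih _ _ ((isPad_nil _).2 hu) hv]
    · obtain ⟨u', rfl, hu⟩ := hu
      obtain ⟨rfl, hv⟩ := hv
      simp only [List.filterMap_cons, er, conv]
      rw [ih _ _ hu ((isPad_nil _).2 hv)]
    · obtain ⟨u', rfl, hu⟩ := hu
      obtain ⟨v', rfl, hv⟩ := hv
      simp only [List.filterMap_cons, er, conv]
      rw [ih _ _ hu hv]

theorem RR_of_conv [Finite E] {R : Set (List E × List E)}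
    (h : IsRegularSet {w | ∃ p ∈ R, w = conv p.1 p.2}) : RR R := by
  have := reg_and reg_isPad (reg_filterMap er h)
  unfold RR
  convert this using 1
  ext w
  constructor
  · rintro ⟨p, hp, h1, h2⟩
    exact ⟨⟨⟨_, h1⟩, _, h2⟩, p, hp, er_conv _ _ _ h1 h2⟩
  · rintro ⟨⟨⟨u, h1⟩, v, h2⟩, p, hp, h3⟩
    refine ⟨p, hp, ?_, ?_⟩
    · refine ⟨h1.1, ?_⟩
      rw [← er_fst, h3, conv_fst]
    · refine ⟨h2.1, ?_⟩
      rw [← er_snd, h3, conv_snd]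

/-- Forget the vertex of a padding letter. -/
def unp {E V : Type} : E ⊕ V → Option E := Sum.elim some (fun _ => none)

theorem map_deltaPair {V : Type} (et : E → V) (u v : List E) :
    (deltaPair et u v).map (Prod.map unp unp) = conv u v := by
  have key : ∀ (s t : Option V) (u v : List E), ((u.map Sum.inl).zip (v.map Sum.inl) ++
    (if u.length ≤ v.length
      then (v.drop u.length).map (fun e => ((Sum.inr s : E ⊕ Option V), (Sum.inl e : E ⊕ Option V)))
      else (u.drop v.length).map (fun e => (Sum.inl e, Sum.inr t)))).map (Prod.map unp unp)
      = conv u v := by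
    intro s t u
    induction u with
    | nil =>
      intro v
      induction v with
      | nil => simp [conv]
      | cons y v ih => simpa [conv, unp] using ih
    | cons x u ih =>
      intro v
      cases v with
      | nil =>
        have := ih []
        cases u with
        | nil => simp [conv, unp]
        | cons x u => simpa [conv, unp] using this
      | cons y v => simpa [conv, unp] using ih v
  exact key _ _ u v

theorem RR_of_sync [Finite E] {V : Type} {et : E → V} {R : Set (List E × List E)}
    (h : SyncRegular et R) : RR R := by
  apply RR_of_conv
  convert reg_image (Prod.map unp unp) h using 1
  ext w
  constructor
  · rintro ⟨p, hp, rfl⟩; exact ⟨_, ⟨p, hp, rfl⟩, map_deltaPair et _ _⟩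
  · rintro ⟨_, ⟨p, hp, rfl⟩, rfl⟩; exact ⟨p, hp, map_deltaPair et _ _⟩

theorem RR_drop [Finite E] (e : E) : RR {p : List E × List E | p.1 = p.2 ++ [e]} := by
  apply RR_of_conv
  have := reg_and (reg_chain' (fun a _ : Option E × Option E => ∃ x, a = (some x, some x)))
    (reg_getLast (fun o => o = some (some e, (none : Option E))))
  convert this using 1
  have e1 : ∀ u : List E, conv (u ++ [e]) u = u.map (fun x => (some x, some x)) ++ [(some e, none)] := by
    intro u
    induction u with
    | nil => simp [conv]
    | cons x u ih => simp [conv, ih]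
  ext w
  constructor
  · rintro ⟨⟨u', u⟩, hu, rfl⟩
    obtain rfl : u' = u ++ [e] := hu
    simp only [e1]
    refine ⟨?_, by simp⟩
    induction u with
    | nil => simp
    | cons x u ih =>
      simp only [List.map_cons, List.cons_append]
      rw [List.isChain_cons]
      exact ⟨fun _ _ => ⟨x, rfl⟩, ih⟩
  · rintro ⟨h1, h2⟩
    suffices ∃ u : List E, w = u.map (fun x => (some x, some x)) ++ [(some e, none)] by
      obtain ⟨u, rfl⟩ := this
      exact ⟨(u ++ [e], u), rfl, (e1 u).symm⟩
    induction w with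
    | nil => simp at h2
    | cons a w ih =>
      cases w with
      | nil => exact ⟨[], by simpa using h2⟩
      | cons b w =>
        rw [List.isChain_cons_cons] at h1
        obtain ⟨⟨x, rfl⟩, h1⟩ := h1
        obtain ⟨u, hu⟩ := ih h1 (by simpa using h2)
        exact ⟨x :: u, by simp [hu]⟩

end Pad

end AutoRees

namespace AutoRees

section Code
variable {E Λ O : Type} (lam : E → Λ) (G : Λ → O)

/-- Encode a word over `E`, each letter remembering the `Λ`-index of the previous one. -/
def codeAux : Option Λ → List E → List (Option Λ × E)
  | _, [] => []
  | o, e :: l => (o, e) :: codeAux (some (lam e)) l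

/-- The `Λ`-index reached at the end of a word. -/
def fin : Option Λ → List E → Option Λ
  | o, [] => o
  | _, e :: l => fin (some (lam e)) l

/-- The encoding of a word. -/
def code (u : List E) : List (Option Λ × E) := codeAux lam none u

/-- Target of an encoded edge. -/
def ctgt (p : Option Λ × E) : O := G (lam p.2)

theorem codeAux_append (o : Option Λ) (u v : List E) :
    codeAux lam o (u ++ v) = codeAux lam o u ++ codeAux lam (fin lam o u) v := by
  induction u generalizing o with
  | nil => rfl
  | cons e u ih => simp [codeAux, fin, ih]

theorem code_concat (u : List E) (e : E) :
    code lam (u ++ [e]) = code lam u ++ [(fin lam none u, e)] := by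
  simp [code, codeAux_append, codeAux]

theorem fin_append (o : Option Λ) (u v : List E) :
    fin lam o (u ++ v) = fin lam (fin lam o u) v := by
  induction u generalizing o with
  | nil => rfl
  | cons e u ih => simp [fin, ih]

theorem fin_concat (o : Option Λ) (u : List E) (e : E) :
    fin lam o (u ++ [e]) = some (lam e) := by
  simp [fin_append, fin]

theorem codeAux_snd (o : Option Λ) (u : List E) : (codeAux lam o u).map Prod.snd = u := by
  induction u generalizing o with
  | nil => rfl
  | cons e u ih => simp [codeAux, ih]

theorem code_snd (u : List E) : (code lam u).map Prod.snd = u := codeAux_snd lam _ u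

theorem code_inj {u v : List E} (h : code lam u = code lam v) : u = v := by
  rw [← code_snd lam u, h, code_snd]

theorem code_nil : code lam ([] : List E) = [] := rfl

theorem code_ne_nil {u : List E} : code lam u ≠ [] ↔ u ≠ [] := by
  cases u <;> simp [code, codeAux]

theorem codeAux_chain (o : Option Λ) (u : List E) :
    (codeAux lam o u).IsChain (fun a b => b.1 = some (lam a.2)) := by
  induction u generalizing o with
  | nil => simp [codeAux]
  | cons e u ih =>
    rw [codeAux, List.isChain_cons]
    refine ⟨?_, ih _⟩
    cases u <;> simp [codeAux]

theorem code_getLast (u : List E) :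
    (code lam u).getLast?.map (ctgt lam G) = (fin lam none u).map G := by
  induction u using List.reverseRecOn with
  | nil => rfl
  | append_singleton u e _ => rw [code_concat, fin_concat]; simp [ctgt]

theorem code_prefix_iff (p : List (Option Λ × E)) (u : List E) :
    p <+: code lam u ↔ ∃ v, v <+: u ∧ p = code lam v := by
  constructor
  · intro h
    refine ⟨u.take p.length, ⟨_, List.take_append_drop _ _⟩, ?_⟩
    have h2 : code lam (u.take p.length) <+: code lam u := by
      conv_rhs => rw [← List.take_append_drop p.length u]
      rw [code, code, codeAux_append]
      exact List.prefix_append _ _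
    have hl : ∀ v, (code lam v).length = v.length := by
      intro v; conv_rhs => rw [← code_snd lam v]
      simp
    have h3 := h.length_le
    rw [hl] at h3
    rw [List.prefix_iff_eq_take] at h h2
    rw [hl, List.length_take, min_eq_left h3] at h2
    rw [h2, ← h]
  · rintro ⟨v, ⟨z, rfl⟩, rfl⟩
    rw [code, code, codeAux_append]
    exact List.prefix_append _ _

theorem prefs_code (K : Set (List E)) : prefs (code lam '' K) = code lam '' (prefs K) := by
  ext p
  constructor
  · rintro ⟨h, _, ⟨u, hu, rfl⟩, hp⟩
    obtain ⟨v, hv, rfl⟩ := (code_prefix_iff lam _ _).1 hp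
    exact ⟨v, ⟨(code_ne_nil lam).1 h, u, hu, hv⟩, rfl⟩
  · rintro ⟨v, ⟨h, u, hu, hv⟩, rfl⟩
    exact ⟨(code_ne_nil lam).2 h, _, ⟨u, hu, rfl⟩, (code_prefix_iff lam _ _).2 ⟨v, hv, rfl⟩⟩

/-- One-component padded encoded words. -/
def D1 : Set (List ((Option Λ × E) ⊕ Option O)) :=
  {x | ∃ u k, x = (code lam u).map Sum.inl ++
    List.replicate k (padSym (ctgt lam G) (code lam u))}

/-- Allowed letters in a given state. -/
def okL (o : Option Λ) : (Option Λ × E) ⊕ Option O → Prop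
  | Sum.inl p => p.1 = o
  | Sum.inr t => t = o.map G

/-- Allowed consecutive letters. -/
def okR : (Option Λ × E) ⊕ Option O → (Option Λ × E) ⊕ Option O → Prop
  | Sum.inl p, y => okL G (some (lam p.2)) y
  | Sum.inr t, y => y = Sum.inr t

theorem okR_inr (t : Option O) (x : List ((Option Λ × E) ⊕ Option O)) :
    (Sum.inr t :: x).IsChain (okR lam G) ↔ ∃ k, x = List.replicate k (Sum.inr t) := by
  induction x with
  | nil => exact ⟨fun _ => ⟨0, rfl⟩, fun _ => by simp⟩
  | cons a x ih =>
    rw [List.isChain_cons_cons]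
    constructor
    · rintro ⟨h, h'⟩
      obtain rfl : a = Sum.inr t := h
      obtain ⟨k, rfl⟩ := ih.1 h'
      exact ⟨k+1, rfl⟩
    · rintro ⟨k, hk⟩
      cases k with
      | zero => simp at hk
      | succ k =>
        simp only [List.replicate_succ, List.cons.injEq] at hk
        obtain ⟨rfl, rfl⟩ := hk
        exact ⟨rfl, ih.2 ⟨k, rfl⟩⟩

theorem D1_aux (x : List ((Option Λ × E) ⊕ Option O)) (o : Option Λ) :
    ((∀ a ∈ x.head?, okL G o a) ∧ x.IsChain (okR lam G)) ↔
    ∃ u k, x = (codeAux lam o u).map Sum.inl ++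
      List.replicate k (Sum.inr ((fin lam o u).map G)) := by
  induction x generalizing o with
  | nil => simp; exact ⟨[], by simp [codeAux]⟩
  | cons a x ih =>
    rcases a with ⟨o', e⟩ | t
    · have : (∀ a ∈ (Sum.inl (o', e) :: x : List ((Option Λ × E) ⊕ Option O)).head?, okL G o a) ∧
          (Sum.inl (o', e) :: x).IsChain (okR lam G) ↔
          o' = o ∧ ((∀ a ∈ x.head?, okL G (some (lam e)) a) ∧ x.IsChain (okR lam G)) := by
        rw [List.isChain_cons]
        simp [okL, okR]
      rw [this, ih]
      constructor
      · rintro ⟨rfl, u, k, rfl⟩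
        exact ⟨e :: u, k, by simp [codeAux, fin]⟩
      · rintro ⟨u, k, h⟩
        cases u with
        | nil => cases k <;> simp [codeAux, List.replicate_succ] at h
        | cons e' u =>
          simp only [codeAux, List.map_cons, List.cons_append, List.cons.injEq, Sum.inl.injEq,
            Prod.mk.injEq, fin] at h
          obtain ⟨⟨rfl, rfl⟩, rfl⟩ := h
          exact ⟨rfl, u, k, rfl⟩
    · rw [okR_inr]
      simp only [List.head?_cons, Option.mem_def, Option.some.injEq, forall_eq']
      constructor
      · rintro ⟨h, k, rfl⟩
        obtain rfl : t = o.map G := h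
        exact ⟨[], k + 1, rfl⟩
      · rintro ⟨u, k, h⟩
        cases u with
        | nil =>
          cases k with
          | zero => simp [codeAux] at h
          | succ k =>
            simp only [codeAux, List.map_nil, List.nil_append, List.replicate_succ,
              List.cons.injEq, Sum.inr.injEq, fin] at h
            obtain ⟨rfl, rfl⟩ := h
            exact ⟨rfl, k, rfl⟩
        | cons e' u => simp [codeAux] at h

theorem reg_D1 [Finite E] [Finite Λ] [Finite O] : IsRegularSet (D1 lam G) := by
  convert reg_chain (okL G none) (okR lam G) using 1
  ext x
  have := (D1_aux lam G x none).symm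
  simp only [D1, padSym, code_getLast]
  exact this

theorem reg_code (G : Λ → O) [Finite E] [Finite Λ] [Finite O] {K : Set (List E)} (h : IsRegularSet K) :
    IsRegularSet (code lam '' K) := by
  convert reg_and (reg_comap (Sum.inl : Option Λ × E → (Option Λ × E) ⊕ Option O) (reg_D1 lam G))
    (reg_comap Prod.snd h) using 1
  ext w
  constructor
  · rintro ⟨u, hu, rfl⟩
    exact ⟨⟨u, 0, by simp⟩, by simpa [code_snd] using hu⟩
  · rintro ⟨⟨u, k, hk⟩, h2⟩
    have : k = 0 := by
      by_contra hk0
      have hm : padSym (ctgt lam G) (code lam u) ∈ w.map (Sum.inl : _ → (Option Λ × E) ⊕ Option O) := by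
        rw [hk]; simp [hk0]
      simp [padSym] at hm
    subst this
    simp only [List.replicate_zero, List.append_nil] at hk
    have := List.map_injective_iff.2 Sum.inl_injective hk
    subst this
    exact ⟨u, by simpa [code_snd] using h2, rfl⟩

theorem zip_fst_take {α β : Type} (a : List α) (b : List β) :
    (a.zip b).map Prod.fst = a.take b.length := by
  induction a generalizing b with
  | nil => simp
  | cons x a ih => cases b <;> simp [ih]

theorem zip_snd_take {α β : Type} (a : List α) (b : List β) :
    (a.zip b).map Prod.snd = b.take a.length := by
  induction a generalizing b with
  | nil => simp
  | cons x a ih => cases b <;> simp [ih]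

theorem delta_fst {E V : Type} (et : E → V) (a b : List E) : (deltaPair et a b).map Prod.fst =
    a.map Sum.inl ++ List.replicate (b.length - a.length) (padSym et a) := by
  unfold deltaPair
  split_ifs with h
  · rw [List.map_append, List.map_fst_zip (by simpa using h), List.map_map]
    congr 1
    apply List.eq_replicate_iff.2
    refine ⟨by simp, fun b hb => ?_⟩
    rw [List.mem_map] at hb
    obtain ⟨e, _, rfl⟩ := hb
    rfl
  · rw [List.map_append, List.map_map, Nat.sub_eq_zero_of_le (by omega)]
    have e1 : (List.map (Prod.fst ∘ fun e => ((Sum.inl e : E ⊕ Option V), padSym et b)) (List.drop b.length a))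
       = List.drop b.length (a.map Sum.inl) := by rw [← List.map_drop]; rfl
    rw [e1, zip_fst_take]
    simp

theorem delta_snd {E V : Type} (et : E → V) (a b : List E) : (deltaPair et a b).map Prod.snd =
    b.map Sum.inl ++ List.replicate (a.length - b.length) (padSym et b) := by
  unfold deltaPair
  split_ifs with h
  · rw [List.map_append, List.map_map, Nat.sub_eq_zero_of_le (by omega)]
    have e1 : (List.map (Prod.snd ∘ fun e => (padSym et a, (Sum.inl e : E ⊕ Option V))) (List.drop a.length b))
       = List.drop a.length (b.map Sum.inl) := by rw [← List.map_drop]; rfl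
    rw [e1, zip_snd_take]
    simp
  · rw [List.map_append, List.map_snd_zip (by simpa using (by omega)), List.map_map]
    congr 1
    apply List.eq_replicate_iff.2
    refine ⟨by simp, fun b hb => ?_⟩
    rw [List.mem_map] at hb
    obtain ⟨e, _, rfl⟩ := hb
    rfl

theorem delta_nopad {E V : Type} (et : E → V) (a b : List E) :
    ∀ p ∈ deltaPair et a b, p.1.isLeft ∨ p.2.isLeft := by
  intro p hp
  unfold deltaPair at hp
  rw [List.mem_append] at hp
  rcases hp with hp | hp
  · left
    have := (List.of_mem_zip (a := p.1) (b := p.2) hp).1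
    rw [List.mem_map] at this
    obtain ⟨e, _, he⟩ := this
    rw [← he]; rfl
  · split_ifs at hp <;> rw [List.mem_map] at hp <;> obtain ⟨e, _, rfl⟩ := hp <;> simp

theorem eq_of_map_fst_snd {α β : Type} : ∀ (w z : List (α × β)), w.map Prod.fst = z.map Prod.fst →
    w.map Prod.snd = z.map Prod.snd → w = z
  | [], [], _, _ => rfl
  | [], _ :: _, h, _ => by simp at h
  | _ :: _, [], h, _ => by simp at h
  | a :: w, b :: z, h, h' => by
    simp only [List.map_cons, List.cons.injEq] at h h'
    rw [Prod.ext h.1 h'.1, eq_of_map_fst_snd w z h.2 h'.2]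

/-- Forget padding vertex and encoding. -/
def unc : (Option Λ × E) ⊕ Option O → Option E := Sum.elim (fun p => some p.2) (fun _ => none)

theorem unc_pad (u : List E) (k : ℕ) :
    IsPad (((code lam u).map Sum.inl ++ List.replicate k (padSym (ctgt lam G) (code lam u))).map unc) u := by
  have := isPad_mk u k
  rw [List.map_append, List.map_map, List.map_replicate]
  have e1 : List.map (unc (O := O) ∘ Sum.inl) (code lam u) = u.map some := by
    conv_rhs => rw [← code_snd lam u]
    rw [List.map_map]; rfl
  rw [e1]
  exact this

theorem sync_code [Finite E] [Finite Λ] [Finite O] {R : Set (List E × List E)} (h : RR R) :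
    SyncRegular (ctgt lam G) {p | ∃ q ∈ R, p = (code lam q.1, code lam q.2)} := by
  unfold SyncRegular
  convert reg_and (reg_and (reg_comap Prod.fst (reg_D1 lam G)) (reg_comap Prod.snd (reg_D1 lam G)))
    (reg_and (reg_all (fun p : ((Option Λ × E) ⊕ Option O) × ((Option Λ × E) ⊕ Option O) =>
      p.1.isLeft ∨ p.2.isLeft))
      (reg_comap (Prod.map unc unc) h)) using 1
  ext w
  constructor
  · rintro ⟨_, ⟨⟨u, v⟩, hq, rfl⟩, rfl⟩
    refine ⟨⟨⟨u, _, delta_fst _ _ _⟩, ⟨v, _, delta_snd _ _ _⟩⟩, delta_nopad _ _ _, ⟨(u, v), hq, ?_, ?_⟩⟩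
    · have := unc_pad lam G u ((code lam v).length - (code lam u).length)
      rw [← delta_fst, List.map_map] at this
      rw [List.map_map]; exact this
    · have := unc_pad lam G v ((code lam u).length - (code lam v).length)
      rw [← delta_snd, List.map_map] at this
      rw [List.map_map]; exact this
  · rintro ⟨⟨⟨u, k, h1⟩, ⟨v, l, h2⟩⟩, h3, h4⟩
    refine ⟨_, ⟨(u, v), ?_, rfl⟩, ?_⟩
    · refine (mem_Pd ?_ ?_).1 h4
      · have := unc_pad lam G u k
        rw [← h1, List.map_map] at this
        rw [List.map_map]; exact this
      · have := unc_pad lam G v l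
        rw [← h2, List.map_map] at this
        rw [List.map_map]; exact this
    · have l1 := congrArg List.length h1
      have l2 := congrArg List.length h2
      simp only [List.length_map, List.length_append, List.length_replicate] at l1 l2
      have hkl : k = 0 ∨ l = 0 := by
        by_contra hc
        push Not at hc
        have hw : w ≠ [] := by
          rintro rfl
          simp at l1; omega
        have g1 := congrArg List.getLast? h1
        have g2 := congrArg List.getLast? h2
        simp only [List.getLast?_map, List.getLast?_append, List.getLast?_replicate, hc.1, hc.2,
          if_false, List.getLast?_eq_some_getLast hw, Option.map_some, Option.some_or,
          Option.some.injEq] at g1 g2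
        have := h3 _ (List.getLast_mem hw)
        rw [g1, g2] at this
        simp [padSym] at this
      apply eq_of_map_fst_snd
      · rw [delta_fst, h1]; simp only; congr 2; omega
      · rw [delta_snd, h2]; simp only; congr 2; omega

end Code

end AutoRees

namespace AutoRees

section Generic

/-- Multiplication with an optional left factor. -/
def opMul {V B : Type} (M : PreSgpd V B) : Option B → B → B
  | none, m => m
  | some k, m => M.mul k m

theorem eval_concat {V B E : Type} (M : PreSgpd V B) (lab : E → B) (u : List E) (e : E) :
    evalPath? M lab (u ++ [e]) = some (opMul M (evalPath? M lab u) (lab e)) := by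
  cases u <;> simp [evalPath?, opMul]

theorem eval_eq_none {V B E : Type} (M : PreSgpd V B) (lab : E → B) (u : List E) :
    evalPath? M lab u = none ↔ u = [] := by
  cases u <;> simp [evalPath?]

variable {B E : Type} (M : PreSgpd Unit B) (C : ChoiceOfReps M E)

theorem pathTgt_unit {u : List E} (h : u ≠ []) (et : E → Unit) (x : Unit) : pathTgt? et u = some x := by
  simp [pathTgt?, List.getLast?_eq_some_getLast h]

theorem RR_right [Finite E] (assoc : ∀ a b c, M.mul (M.mul a b) c = M.mul a (M.mul b c))
    (hC : IsAutomaticStructure C) (w : List E) (m : B) (hw : evalPath? M C.lab w = some m) :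
    RR {p : List E × List E | p.1 ∈ C.K ∧ p.2 ∈ C.K ∧
      evalPath? M C.lab p.2 = some (opMul M (evalPath? M C.lab p.1) m)} := by
  have hedge : ∀ e, RR {p : List E × List E | p.1 ∈ C.K ∧ p.2 ∈ C.K ∧
      evalPath? M C.lab p.2 = some (opMul M (evalPath? M C.lab p.1) (C.lab e))} := by
    intro e
    convert RR_of_sync (hC.2.2.1 e) using 1
    ext ⟨u, v⟩
    constructor
    · rintro ⟨h1, h2, h3⟩
      exact ⟨h1, h2, pathTgt_unit (C.K_path _ h1).1 _ _, by rw [eval_concat, h3]⟩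
    · rintro ⟨h1, h2, _, h3⟩
      exact ⟨h1, h2, by rw [← h3, eval_concat]⟩
  induction w using List.reverseRecOn generalizing m with
  | nil => simp [evalPath?] at hw
  | append_singleton w e ih =>
    rw [eval_concat] at hw
    cases hm : evalPath? M C.lab w with
    | none =>
      rw [hm] at hw
      obtain rfl : C.lab e = m := by simpa [opMul] using hw
      exact hedge e
    | some m' =>
      rw [hm] at hw
      obtain rfl : M.mul m' (C.lab e) = m := by simpa [opMul] using hw
      convert (ih m' hm).comp (hedge e) using 1
      ext ⟨u, v⟩
      constructor
      · rintro ⟨h1, h2, h3⟩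
        obtain ⟨k, hk, hk'⟩ := C.K_onto (opMul M (evalPath? M C.lab u) m')
        refine ⟨k, ⟨h1, hk, hk'⟩, hk, h2, ?_⟩
        simp only at h3 ⊢
        rw [h3, hk']
        cases evalPath? M C.lab u <;> simp [opMul, assoc]
      · rintro ⟨k, ⟨h1, hk, hk'⟩, _, h2, h3⟩
        refine ⟨h1, h2, ?_⟩
        simp only at h3 hk' ⊢
        rw [h3, hk']
        cases evalPath? M C.lab u <;> simp [opMul, assoc]

theorem RR_relEq [Finite E] (hC : IsAutomaticStructure C) : RR (relEq C) := by
  convert RR_of_sync (hC.2.2.2 ()) using 1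
  ext ⟨u, v⟩
  constructor
  · rintro ⟨h1, h2, h3⟩
    exact ⟨h1, h2, pathTgt_unit (C.K_path _ h1).1 _ _, h3⟩
  · rintro ⟨h1, h2, _, h3⟩
    exact ⟨h1, h2, h3⟩

theorem RR_T [Finite E] (assoc : ∀ a b c, M.mul (M.mul a b) c = M.mul a (M.mul b c))
    (hC : IsPrefixAutomaticStructure C) (m : B) :
    RR {p : List E × List E | p.2 ∈ C.K ∧ (p.1 = [] ∨ p.1 ∈ prefs C.K) ∧
      evalPath? M C.lab p.2 = some (opMul M (evalPath? M C.lab p.1) m)} := by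
  obtain ⟨w, hwK, hw⟩ := C.K_onto m
  have h1 := (RR.prod (reg_singleton ([] : List E)) (reg_singleton w)).comp (RR_relEq M C hC.1)
  have h2 := ((RR_of_sync hC.2).swap).comp (RR_right M C assoc hC.1 w m hw)
  convert h1.union h2 using 1
  ext ⟨u, v⟩
  constructor
  · rintro ⟨hv, hu | hu, h⟩
    · left
      obtain rfl : u = [] := hu
      refine ⟨w, ⟨rfl, rfl⟩, hwK, hv, ?_⟩
      simp only at h ⊢
      rw [hw, h]; rfl
    · right
      simp only at hv hu h
      have hne : evalPath? M C.lab u ≠ none := by rw [Ne, eval_eq_none]; exact hu.1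
      obtain ⟨x, hx⟩ := Option.ne_none_iff_exists'.1 hne
      obtain ⟨k, hk, hk'⟩ := C.K_onto x
      refine ⟨k, ⟨hk, hu, hk'.trans hx.symm⟩, hk, hv, ?_⟩
      simp only
      rw [h, hk', hx]
  · rintro (⟨k, ⟨hu, hk⟩, _, hv, h⟩ | ⟨k, ⟨hk, hu, h1⟩, _, hv, h2⟩)
    · obtain rfl : u = [] := hu
      obtain rfl : k = w := hk
      refine ⟨hv, Or.inl rfl, ?_⟩
      simp only at h ⊢
      rw [← h, hw]; rfl
    · refine ⟨hv, Or.inr hu, ?_⟩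
      simp only at h1 h2 ⊢
      rw [h2, h1]

theorem RR_Q [Finite E] (assoc : ∀ a b c, M.mul (M.mul a b) c = M.mul a (M.mul b c))
    (hC : IsPrefixAutomaticStructure C) (f : E → Option B) :
    RR {p : List E × List E | ∃ u e m, p.1 = u ++ [e] ∧ f e = some m ∧ p.2 ∈ C.K ∧
      (u = [] ∨ u ∈ prefs C.K) ∧
      evalPath? M C.lab p.2 = some (opMul M (evalPath? M C.lab u) m)} := by
  have : ∀ e, RR {p : List E × List E | ∃ u m, p.1 = u ++ [e] ∧ f e = some m ∧ p.2 ∈ C.K ∧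
      (u = [] ∨ u ∈ prefs C.K) ∧
      evalPath? M C.lab p.2 = some (opMul M (evalPath? M C.lab u) m)} := by
    intro e
    cases hf : f e with
    | none =>
      convert RR.prod (reg_empty (α := E)) (reg_empty (α := E)) using 1
      ext p
      simp
    | some m =>
      convert (RR_drop e).comp (RR_T M C assoc hC m) using 1
      ext p
      constructor
      · rintro ⟨u, m', h1, h2, h3⟩
        obtain rfl : m = m' := by simpa using h2
        exact ⟨u, h1, h3⟩
      · rintro ⟨u, h1, h3⟩
        exact ⟨u, m, h1, rfl, h3⟩
  convert RR.iUnion this using 1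
  ext p
  simp only [Set.mem_iUnion, Set.mem_ofPred_eq]
  grind

end Generic

section Main

variable {O A I Λ E : Type} (S : Sgpd O A) (R : Rees.Data S I Λ)

theorem rees_assoc (a b c : Rees.Carrier S R) :
    (Rees.pre S R).mul ((Rees.pre S R).mul a b) c = (Rees.pre S R).mul a ((Rees.pre S R).mul b c) := by
  obtain ⟨⟨i, x, l⟩, hx1, hx2⟩ := a
  obtain ⟨⟨j, y, m⟩, hy1, hy2⟩ := b
  obtain ⟨⟨k, z, n⟩, hz1, hz2⟩ := c
  simp only at hx1 hx2 hy1 hy2 hz1 hz2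
  apply Subtype.ext
  show (i, S.mul (S.mul (S.mul (S.mul x (R.P l j)) y) (R.P m k)) z, n) =
    (i, S.mul (S.mul x (R.P l j)) (S.mul (S.mul y (R.P m k)) z), n)
  have p1 := R.P_src l j
  have p2 := R.P_tgt l j
  have q1 := R.P_src m k
  have q2 := R.P_tgt m k
  have t1 : S.tgt (S.mul x (R.P l j)) = S.src y := by rw [S.tgt_mul _ _ (by rw [hx2, p1]), p2, hy1]
  have t2 : S.tgt y = S.src (R.P m k) := by rw [hy2, q1]
  have t3 : S.tgt (S.mul y (R.P m k)) = S.src z := by rw [S.tgt_mul _ _ t2, q2, hz1]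
  rw [S.mul_assoc' (S.mul x (R.P l j)) y (R.P m k) t1 t2,
    S.mul_assoc' _ _ _ (by rw [S.src_mul _ _ t2, t1]) t3]

variable (C : ChoiceOfReps (Rees.pre S R) E)

/-- Row index of a generator. -/
def ii (e : E) : I := (C.lab e).1.1
/-- Middle entry of a generator. -/
def xx (e : E) : A := (C.lab e).1.2.1
/-- Column index of a generator. -/
def ll (e : E) : Λ := (C.lab e).1.2.2

theorem hF (e : E) : R.F (ii S R C e) = S.src (xx S R C e) := (C.lab e).2.1
theorem hG (e : E) : S.tgt (xx S R C e) = R.G (ll S R C e) := (C.lab e).2.2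

/-- Sources of the new edges. -/
def nsrc : Option Λ × E → O
  | (none, e) => R.F (ii S R C e)
  | (some l, _) => R.G l

/-- Labels of the new edges. -/
def nlab : Option Λ × E → A
  | (none, e) => xx S R C e
  | (some l, e) => S.mul (R.P l (ii S R C e)) (xx S R C e)

theorem nlab_src (p : Option Λ × E) : S.src (nlab S R C p) = nsrc S R C p := by
  obtain ⟨_ | l, e⟩ := p
  · exact (hF S R C e).symm
  · show S.src (S.mul _ _) = R.G l
    rw [S.src_mul _ _ (by rw [R.P_tgt, hF]), R.P_src]

theorem nlab_tgt (p : Option Λ × E) : S.tgt (nlab S R C p) = ctgt (ll S R C) R.G p := by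
  obtain ⟨_ | l, e⟩ := p
  · exact hG S R C e
  · show S.tgt (S.mul _ _) = R.G (ll S R C e)
    rw [S.tgt_mul _ _ (by rw [R.P_tgt, hF]), hG]

theorem eval_code (u : List E) :
    evalPath? S.toPreSgpd (nlab S R C) (code (ll S R C) u) =
      (evalPath? (Rees.pre S R) C.lab u).map (fun m => m.1.2.1) ∧
    fin (ll S R C) none u = (evalPath? (Rees.pre S R) C.lab u).map (fun m => m.1.2.2) := by
  induction u using List.reverseRecOn with
  | nil => exact ⟨rfl, rfl⟩
  | append_singleton u e ih =>
    rw [code_concat, eval_concat, eval_concat, fin_concat, ih.1, ih.2]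
    cases hm : evalPath? (Rees.pre S R) C.lab u with
    | none => exact ⟨rfl, rfl⟩
    | some m =>
      refine ⟨?_, rfl⟩
      show some (S.mul m.1.2.1 (S.mul (R.P m.1.2.2 (ii S R C e)) (xx S R C e))) =
        some (S.mul (S.mul m.1.2.1 (R.P m.1.2.2 (ii S R C e))) (xx S R C e))
      rw [S.mul_assoc']
      · rw [R.P_src]; exact m.2.2
      · rw [R.P_tgt, hF]

theorem eval_head (u : List E) : u.head?.map (ii S R C) =
    (evalPath? (Rees.pre S R) C.lab u).map (fun m => m.1.1) := by
  induction u using List.reverseRecOn with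
  | nil => rfl
  | append_singleton u e ih =>
    rw [eval_concat]
    cases hm : evalPath? (Rees.pre S R) C.lab u with
    | none =>
      obtain rfl := (eval_eq_none _ _ _).1 hm
      rfl
    | some m =>
      rw [hm] at ih
      cases u with
      | nil => simp at ih
      | cons a u =>
        show some (ii S R C a) = some m.1.1
        simpa using ih

theorem eval_last (u : List E) : u.getLast?.map (ll S R C) =
    (evalPath? (Rees.pre S R) C.lab u).map (fun m => m.1.2.2) := by
  induction u using List.reverseRecOn with
  | nil => rfl
  | append_singleton u e ih =>
    rw [eval_concat]
    cases hm : evalPath? (Rees.pre S R) C.lab u with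
    | none => simp [opMul]; rfl
    | some m => simp [opMul]; rfl

/-- Representative of a row index. -/
noncomputable def rF [Nonempty I] (i : I) : I := Function.invFun R.F (R.F i)
/-- Representative of a column index. -/
noncomputable def rG [Nonempty Λ] (l : Λ) : Λ := Function.invFun R.G (R.G l)

theorem F_rF [Nonempty I] (i : I) : R.F (rF S R i) = R.F i := Function.invFun_eq ⟨i, rfl⟩
theorem G_rG [Nonempty Λ] (i : Λ) : R.G (rG S R i) = R.G i := Function.invFun_eq ⟨i, rfl⟩
theorem rF_congr [Nonempty I] {i j : I} (h : R.F i = R.F j) : rF S R i = rF S R j := by simp [rF, h]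
theorem rG_congr [Nonempty Λ] {i j : Λ} (h : R.G i = R.G j) : rG S R i = rG S R j := by simp [rG, h]

variable [Nonempty I] [Nonempty Λ]

/-- The restricted language. -/
def K0 : Set (List E) := {u | u ∈ C.K ∧ (∀ e ∈ u.head?, rF S R (ii S R C e) = ii S R C e) ∧
  (∀ e ∈ u.getLast?, rG S R (ll S R C e) = ll S R C e)}

theorem K0_reg [Finite E] (h : IsRegularSet C.K) : IsRegularSet (K0 S R C) :=
  reg_and h (reg_and (reg_head _) (reg_getLast (fun o => ∀ e ∈ o, rG S R (ll S R C e) = ll S R C e)))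

theorem prefs_reg {K : Set (List E)} [Finite E] (h : IsRegularSet K) : IsRegularSet (prefs K) := by
  have := reg_and (reg_getLast (α := E) (fun o => o ≠ none)) (reg_quot Set.univ h)
  convert this using 1
  ext p
  constructor
  · rintro ⟨h1, l, hl, z, rfl⟩
    exact ⟨by simpa using h1, z, trivial, hl⟩
  · rintro ⟨h1, z, _, hl⟩
    exact ⟨by simpa using h1, _, hl, z, rfl⟩

/-- The new choice of representatives. -/
def newC : ChoiceOfReps S.toPreSgpd (Option Λ × E) where
  esrc := nsrc S R C
  etgt := ctgt (ll S R C) R.G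
  lab := nlab S R C
  lab_src := nlab_src S R C
  lab_tgt := nlab_tgt S R C
  K := code (ll S R C) '' K0 S R C
  K_path := by
    rintro _ ⟨u, hu, rfl⟩
    refine ⟨(code_ne_nil _).2 (C.K_path u hu.1).1, ?_⟩
    refine List.IsChain.imp ?_ (codeAux_chain (ll S R C) none u)
    rintro ⟨o, e⟩ ⟨o', e'⟩ h
    obtain rfl : o' = some (ll S R C e) := h
    rfl
  K_onto := by
    intro a
    obtain ⟨i, hi⟩ := R.F_onto a
    obtain ⟨l, hl⟩ := R.G_onto a
    let m : Rees.Carrier S R := ⟨(rF S R i, a, rG S R l), by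
      constructor
      · show R.F (rF S R i) = S.src a
        rw [F_rF, hi]
      · show S.tgt a = R.G (rG S R l)
        rw [G_rG, hl]⟩
    obtain ⟨u, hu, hm⟩ := C.K_onto m
    refine ⟨_, ⟨u, ⟨hu, ?_, ?_⟩, rfl⟩, ?_⟩
    · intro e he
      have := eval_head S R C u
      rw [hm, he] at this
      have h2 : ii S R C e = rF S R i := by simpa using this
      rw [h2]
      exact rF_congr S R (F_rF S R i)
    · intro e he
      have := eval_last S R C u
      rw [hm, he] at this
      have h2 : ll S R C e = rG S R l := by simpa using this
      rw [h2]
      exact rG_congr S R (G_rG S R l)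
    · rw [(eval_code S R C u).1, hm]; rfl

theorem K0_eval {u : List E} (hu : u ∈ K0 S R C) : ∃ m, evalPath? (Rees.pre S R) C.lab u = some m ∧
    rF S R m.1.1 = m.1.1 ∧ rG S R m.1.2.2 = m.1.2.2 := by
  have hne : evalPath? (Rees.pre S R) C.lab u ≠ none := by
    rw [Ne, eval_eq_none]; exact (C.K_path u hu.1).1
  obtain ⟨m, hm⟩ := Option.ne_none_iff_exists'.1 hne
  refine ⟨m, hm, ?_, ?_⟩
  · have := eval_head S R C u
    rw [hm] at this
    simp only [Option.map_some, Option.map_eq_some_iff] at this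
    obtain ⟨e, he, h⟩ := this
    rw [← h]; exact hu.2.1 e he
  · have := eval_last S R C u
    rw [hm] at this
    simp only [Option.map_some, Option.map_eq_some_iff] at this
    obtain ⟨e, he, h⟩ := this
    rw [← h]; exact hu.2.2 e he

theorem prefs_K0 {u : List E} (hu : u ∈ prefs (K0 S R C)) :
    ∃ m, evalPath? (Rees.pre S R) C.lab u = some m ∧ rF S R m.1.1 = m.1.1 := by
  obtain ⟨hne, l, hl, z, rfl⟩ := hu
  have hne : evalPath? (Rees.pre S R) C.lab u ≠ none := by
    rw [Ne, eval_eq_none]; exact hne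
  obtain ⟨m, hm⟩ := Option.ne_none_iff_exists'.1 hne
  refine ⟨m, hm, ?_⟩
  have := eval_head S R C u
  rw [hm] at this
  simp only [Option.map_some, Option.map_eq_some_iff] at this
  obtain ⟨e, he, h⟩ := this
  rw [← h]; exact hl.2.1 e (by simp [List.head?_append, he])

theorem prefs_of_concat {K : Set (List E)} {u : List E} {e : E} (h : u ++ [e] ∈ prefs K) :
    u = [] ∨ u ∈ prefs K := by
  by_cases hu : u = []
  · exact Or.inl hu
  · obtain ⟨_, l, hl, z, hz⟩ := h
    exact Or.inr ⟨hu, l, hl, [e] ++ z, by rw [← hz]; simp⟩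

theorem carrier_ext {m n : Rees.Carrier S R} (h1 : m.1.1 = n.1.1) (h2 : m.1.2.1 = n.1.2.1)
    (h3 : m.1.2.2 = n.1.2.2) : m = n :=
  Subtype.ext (Prod.ext h1 (Prod.ext h2 h3))

theorem opMul_right (o : Option (Rees.Carrier S R)) (m n : Rees.Carrier S R) (y : A)
    (hi : m.1.1 = n.1.1) (hy : S.tgt m.1.2.1 = S.src y) (hx : n.1.2.1 = S.mul m.1.2.1 y) :
    (opMul (Rees.pre S R) o n).1.1 = (opMul (Rees.pre S R) o m).1.1 ∧
    (opMul (Rees.pre S R) o n).1.2.1 = S.mul (opMul (Rees.pre S R) o m).1.2.1 y ∧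
    (opMul (Rees.pre S R) o n).1.2.2 = n.1.2.2 := by
  cases o with
  | none => exact ⟨hi.symm, hx, rfl⟩
  | some k =>
    refine ⟨rfl, ?_, rfl⟩
    show S.mul (S.mul k.1.2.1 (R.P k.1.2.2 n.1.1)) n.1.2.1 =
      S.mul (S.mul (S.mul k.1.2.1 (R.P k.1.2.2 m.1.1)) m.1.2.1) y
    rw [hx, ← hi, S.mul_assoc' _ _ _ _ hy]
    rw [S.tgt_mul _ _ (by rw [R.P_src]; exact k.2.2), R.P_tgt]
    exact m.2.1

theorem opMul_same (o : Option (Rees.Carrier S R)) (m n : Rees.Carrier S R)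
    (hi : m.1.1 = n.1.1) (hx : n.1.2.1 = m.1.2.1) :
    (opMul (Rees.pre S R) o n).1.1 = (opMul (Rees.pre S R) o m).1.1 ∧
    (opMul (Rees.pre S R) o n).1.2.1 = (opMul (Rees.pre S R) o m).1.2.1 ∧
    (opMul (Rees.pre S R) o n).1.2.2 = n.1.2.2 := by
  cases o with
  | none => exact ⟨hi.symm, hx, rfl⟩
  | some k =>
    refine ⟨rfl, ?_, rfl⟩
    show S.mul (S.mul k.1.2.1 (R.P k.1.2.2 n.1.1)) n.1.2.1 =
      S.mul (S.mul k.1.2.1 (R.P k.1.2.2 m.1.1)) m.1.2.1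
    rw [hx, hi]

/-- Valid elements with the same middle entry and normalised indices agree. -/
theorem norm_eq {m n : Rees.Carrier S R} (hm : rF S R m.1.1 = m.1.1) (hn : rF S R n.1.1 = n.1.1)
    (hm' : rG S R m.1.2.2 = m.1.2.2) (hn' : rG S R n.1.2.2 = n.1.2.2)
    (h : m.1.2.1 = n.1.2.1) : m = n := by
  refine carrier_ext S R ?_ h ?_
  · rw [← hm, ← hn]
    refine rF_congr S R ?_
    rw [m.2.1, n.2.1, h]
  · rw [← hm', ← hn']
    refine rG_congr S R ?_
    rw [← m.2.2, ← n.2.2, h]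

theorem pathTgt_code (u : List E) (e : E) :
    pathTgt? (ctgt (ll S R C) R.G) (code (ll S R C) (u ++ [e])) = some (R.G (ll S R C e)) := by
  unfold pathTgt?
  rw [code_getLast, fin_concat]; rfl

theorem edge_code [Finite E] [Finite Λ] [Finite O] (hC : IsPrefixAutomaticStructure C)
    (a : Option Λ × E) :
    SyncRegular (newC S R C).etgt (relEdge (newC S R C) a) := by
  classical
  let f : E → Option (Rees.Carrier S R) := fun e =>
    if h : R.G (ll S R C e) = nsrc S R C a then
      some ⟨(ii S R C e, S.mul (xx S R C e) (nlab S R C a), rG S R (ll S R C a.2)), by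
        have h0 : S.tgt (xx S R C e) = S.src (nlab S R C a) := by rw [nlab_src, hG, h]
        constructor
        · show R.F (ii S R C e) = S.src (S.mul _ _)
          rw [S.src_mul _ _ h0, hF]
        · show S.tgt (S.mul _ _) = R.G (rG S R _)
          rw [S.tgt_mul _ _ h0, nlab_tgt, G_rG]; rfl⟩
    else none
  have hQ := (RR_Q _ C (rees_assoc S R) hC f).inter
    (RR.prod (K0_reg S R C hC.1.2.1) (K0_reg S R C hC.1.2.1))
  have := sync_code (ll S R C) R.G hQ
  show SyncRegular (ctgt (ll S R C) R.G) _
  convert this using 1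
  have key : ∀ u e v, u ++ [e] ∈ K0 S R C → v ∈ K0 S R C →
      ((R.G (ll S R C e) = nsrc S R C a ∧
        evalPath? S.toPreSgpd (nlab S R C) (code (ll S R C) (u ++ [e]) ++ [a]) =
        evalPath? S.toPreSgpd (nlab S R C) (code (ll S R C) v)) ↔
      ∃ m, f e = some m ∧ evalPath? (Rees.pre S R) C.lab v =
        some (opMul (Rees.pre S R) (evalPath? (Rees.pre S R) C.lab u) m)) := by
    intro u e v hu hv
    obtain ⟨U, hU, hU1, hU2⟩ := K0_eval S R C hu
    obtain ⟨V, hV, hV1, hV2⟩ := K0_eval S R C hv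
    rw [eval_concat, (eval_code S R C _).1, (eval_code S R C _).1, hU, hV]
    rw [eval_concat] at hU
    have hU := Option.some.inj hU
    by_cases h : R.G (ll S R C e) = nsrc S R C a
    · simp only [f, h, dite_true, Option.some.injEq, true_and, Option.map_some]
      have h0 : S.tgt (xx S R C e) = S.src (nlab S R C a) := by rw [nlab_src, hG, h]
      generalize_proofs pf
      obtain ⟨c1, c2, c3⟩ := opMul_right S R (evalPath? (Rees.pre S R) C.lab u) (C.lab e)
        ⟨(ii S R C e, S.mul (xx S R C e) (nlab S R C a), rG S R (ll S R C a.2)), pf⟩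
        (nlab S R C a) rfl h0 rfl
      rw [hU] at c1 c2
      constructor
      · intro hh
        refine ⟨_, rfl, ?_⟩
        apply norm_eq S R hV1 _ hV2
        · rw [c3]; exact rG_congr S R (G_rG S R _)
        · rw [c2]; exact hh.symm
        · rw [c1]; exact hU1
      · rintro ⟨m, hm, hh⟩
        obtain rfl := Option.some.inj hm
        show S.mul U.1.2.1 (nlab S R C a) = V.1.2.1
        rw [hh, c2]
    · simp [f, h]
  ext ⟨p, q⟩
  constructor
  · rintro ⟨⟨u, hu, hup⟩, ⟨v, hv, hvq⟩, h1, h2⟩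
    obtain rfl : code (ll S R C) u = p := hup
    obtain rfl : code (ll S R C) v = q := hvq
    refine ⟨(u, v), ⟨?_, hu, hv⟩, rfl⟩
    rcases List.eq_nil_or_concat' u with rfl | ⟨u, e, rfl⟩
    · exact absurd rfl (C.K_path _ hu.1).1
    · have h1' : R.G (ll S R C e) = nsrc S R C a := by
        have := (pathTgt_code S R C u e).symm.trans h1
        exact Option.some.inj this
      obtain ⟨m, hm, hm'⟩ := (key u e v hu hv).1 ⟨h1', h2⟩
      exact ⟨u, e, m, rfl, hm, hv.1,
        prefs_of_concat ⟨by simp, _, hu.1, List.prefix_rfl⟩, hm'⟩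
  · rintro ⟨⟨u', v⟩, ⟨⟨u, e, m, h1, hm, _, _, h4⟩, hu, hv⟩, hpq⟩
    obtain rfl : u' = u ++ [e] := h1
    obtain ⟨rfl, rfl⟩ := Prod.mk.inj hpq
    obtain ⟨g1, g2⟩ := (key u e v hu hv).2 ⟨m, hm, h4⟩
    exact ⟨⟨_, hu, rfl⟩, ⟨_, hv, rfl⟩, (pathTgt_code S R C u e).trans (congrArg some g1), g2⟩

theorem vertex_code [Finite E] [Finite Λ] [Finite O] (hC : IsAutomaticStructure C) (x : O) :
    SyncRegular (newC S R C).etgt (relVertex (newC S R C) x) := by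
  have hQ := (RR_relEq _ C hC).inter
    (RR.prod (reg_inter (K0_reg S R C hC.2.1)
      (reg_getLast (fun o => o.map (fun e => R.G (ll S R C e)) = some x))) (K0_reg S R C hC.2.1))
  have := sync_code (ll S R C) R.G hQ
  show SyncRegular (ctgt (ll S R C) R.G) _
  convert this using 1
  have ht : ∀ u : List E, pathTgt? (ctgt (ll S R C) R.G) (code (ll S R C) u) =
      u.getLast?.map (fun e => R.G (ll S R C e)) := by
    intro u
    rcases List.eq_nil_or_concat' u with rfl | ⟨u, e, rfl⟩
    · rfl
    · rw [pathTgt_code]; simp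
  ext ⟨p, q⟩
  constructor
  · rintro ⟨⟨u, hu, hup⟩, ⟨v, hv, hvq⟩, h1, h2⟩
    obtain rfl : code (ll S R C) u = p := hup
    obtain rfl : code (ll S R C) v = q := hvq
    refine ⟨(u, v), ⟨⟨hu.1, hv.1, ?_⟩, ⟨hu, (ht u).symm.trans h1⟩, hv⟩, rfl⟩
    obtain ⟨U, hU, hU1, hU2⟩ := K0_eval S R C hu
    obtain ⟨V, hV, hV1, hV2⟩ := K0_eval S R C hv
    change evalPath? S.toPreSgpd (nlab S R C) (code (ll S R C) u) =
      evalPath? S.toPreSgpd (nlab S R C) (code (ll S R C) v) at h2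
    rw [(eval_code S R C _).1, (eval_code S R C _).1, hU, hV] at h2
    simp only
    rw [hU, hV, norm_eq S R hU1 hV1 hU2 hV2 (by simpa using h2)]
  · rintro ⟨⟨u, v⟩, ⟨⟨_, _, h⟩, ⟨hu, hu'⟩, hv⟩, hpq⟩
    obtain ⟨rfl, rfl⟩ := Prod.mk.inj hpq
    refine ⟨⟨_, hu, rfl⟩, ⟨_, hv, rfl⟩, (ht u).trans hu', ?_⟩
    show evalPath? S.toPreSgpd (nlab S R C) (code (ll S R C) u) =
      evalPath? S.toPreSgpd (nlab S R C) (code (ll S R C) v)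
    simp only at h
    rw [(eval_code S R C _).1, (eval_code S R C _).1, h]

theorem pref_code [Finite E] [Finite Λ] [Finite O] (hC : IsPrefixAutomaticStructure C) :
    SyncRegular (newC S R C).etgt (relPrefEq (newC S R C)) := by
  let g : E → Rees.Carrier S R := fun e =>
      ⟨(ii S R C e, xx S R C e, rG S R (ll S R C e)), by
        constructor
        · exact hF S R C e
        · show S.tgt (xx S R C e) = R.G (rG S R _)
          rw [hG, G_rG]⟩
  have hQ := (RR_Q _ C (rees_assoc S R) hC (fun e => some (g e))).swap.inter
    (RR.prod (K0_reg S R C hC.1.2.1) (prefs_reg (K0_reg S R C hC.1.2.1)))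
  have := sync_code (ll S R C) R.G hQ
  show SyncRegular (ctgt (ll S R C) R.G) _
  convert this using 1
  have key : ∀ u e v, u ++ [e] ∈ prefs (K0 S R C) → v ∈ K0 S R C →
      ((evalPath? S.toPreSgpd (nlab S R C) (code (ll S R C) v) =
        evalPath? S.toPreSgpd (nlab S R C) (code (ll S R C) (u ++ [e]))) ↔
      evalPath? (Rees.pre S R) C.lab v =
        some (opMul (Rees.pre S R) (evalPath? (Rees.pre S R) C.lab u) (g e))) := by
    intro u e v hu hv
    obtain ⟨U, hU, hU1⟩ := prefs_K0 S R C hu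
    obtain ⟨V, hV, hV1, hV2⟩ := K0_eval S R C hv
    rw [(eval_code S R C _).1, (eval_code S R C _).1, hU, hV]
    rw [eval_concat] at hU
    have hU := Option.some.inj hU
    obtain ⟨c1, c2, c3⟩ := opMul_same S R (evalPath? (Rees.pre S R) C.lab u) (C.lab e)
        (g e) rfl rfl
    rw [hU] at c1 c2
    simp only [Option.map_some, Option.some.injEq]
    constructor
    · intro hh
      apply norm_eq S R hV1 _ hV2
      · rw [c3]; exact rG_congr S R (G_rG S R _)
      · rw [c2]; exact hh
      · rw [c1]; exact hU1
    · intro hh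
      rw [hh, c2]
  ext ⟨q, p⟩
  constructor
  · rintro ⟨⟨v, hv, hvq⟩, hp, h2⟩
    obtain rfl : code (ll S R C) v = q := hvq
    change p ∈ prefs (code (ll S R C) '' K0 S R C) at hp
    rw [prefs_code] at hp
    obtain ⟨u, hu, rfl⟩ := hp
    refine ⟨(v, u), ⟨?_, hv, hu⟩, rfl⟩
    rcases List.eq_nil_or_concat' u with rfl | ⟨u, e, rfl⟩
    · exact absurd rfl hu.1
    · refine ⟨u, e, _, rfl, rfl, hv.1, prefs_of_concat (e := e) ?_, (key u e v hu hv).1 h2⟩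
      obtain ⟨h, l, hl, hl'⟩ := hu
      exact ⟨h, l, hl.1, hl'⟩
  · rintro ⟨⟨v, u'⟩, ⟨⟨u, e, m, h1, hm, _, _, h4⟩, hv, hu⟩, hpq⟩
    obtain rfl : u' = u ++ [e] := h1
    obtain rfl : g e = m := Option.some.inj hm
    obtain ⟨rfl, rfl⟩ := Prod.mk.inj hpq
    refine ⟨⟨_, hv, rfl⟩, ?_, (key u e v hu hv).2 h4⟩
    show _ ∈ prefs (code (ll S R C) '' K0 S R C)
    rw [prefs_code]
    exact ⟨_, hu, rfl⟩

end Main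

end AutoRees

namespace AutoRees

/-- Theorem 6.4: if a Rees matrix semigroup without zero is prefix-automatic
then the underlying semigroupoid is prefix-automatic. -/
theorem stmt_18 {O A I Λ : Type} (S : Sgpd O A) (hne : Nonempty A)
    (hiso : IsolationFree S.toPreSgpd)
    (R : Rees.Data S I Λ)
    (hM : IsPrefixAutomatic (Rees.pre S R)) :
    IsPrefixAutomatic S.toPreSgpd := by
  obtain ⟨E, C, hC⟩ := hM
  have hE : Finite E := hC.1.1
  obtain ⟨a0⟩ := hne
  have hI : Nonempty I := (R.F_onto a0).nonempty
  have hΛ : Nonempty Λ := (R.G_onto a0).nonempty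
  have fI : Finite I := by
    refine Finite.of_surjective (ii S R C) fun i => ?_
    obtain ⟨a, ha⟩ := R.F_into i
    obtain ⟨l, hl⟩ := R.G_onto a
    obtain ⟨u, _, hu⟩ := C.K_onto ⟨(i, a, l), ha.symm, hl.symm⟩
    have := eval_head S R C u
    rw [hu] at this
    obtain ⟨e, _, h⟩ := Option.map_eq_some_iff.1 (this.trans (rfl : _ = some i))
    exact ⟨e, h⟩
  have fΛ : Finite Λ := by
    refine Finite.of_surjective (ll S R C) fun l => ?_
    obtain ⟨a, ha⟩ := R.G_into l
    obtain ⟨i, hi⟩ := R.F_onto a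
    obtain ⟨u, _, hu⟩ := C.K_onto ⟨(i, a, l), hi, ha⟩
    have := eval_last S R C u
    rw [hu] at this
    obtain ⟨e, _, h⟩ := Option.map_eq_some_iff.1 (this.trans (rfl : _ = some l))
    exact ⟨e, h⟩
  have fO : Finite O := by
    refine Finite.of_surjective (Sum.elim R.F R.G) fun v => ?_
    obtain ⟨a, ha | ha⟩ := hiso v
    · obtain ⟨i, hi⟩ := R.F_onto a
      exact ⟨Sum.inl i, hi.trans ha⟩
    · obtain ⟨l, hl⟩ := R.G_onto a
      exact ⟨Sum.inr l, hl.trans ha⟩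
  exact ⟨Option Λ × E, newC S R C,
    ⟨inferInstance, reg_code (ll S R C) R.G (K0_reg S R C hC.1.2.1),
      fun a => edge_code S R C hC a, fun v => vertex_code S R C hC.1 v⟩, pref_code S R C hC⟩

end AutoRees
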